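/- If I is a monomial ideal in S = k[x_1,...,x_n] and e ≥ deg(I) is an integer (deg(I) the maximal degree of a minimal generator) such that I_{≥e} is stable, then the Castelnuovo–Mumford regularity of I satisfies reg(I) ≤ e. -/

import Mathlib

open MvPolynomial

noncomputable section

/-- The ideal generated by all monomials of `I` of total degree at least `t`. -/
def trunc {K : Type*} [Field K] {n : ℕ} (I : Ideal (MvPolynomial (Fin n) K)) (t : ℕ) :
    Ideal (MvPolynomial (Fin n) K) :=
  Ideal.span { p | ∃ v : Fin n →₀ ℕ, p = monomial v (1 : K) ∧ p ∈ I ∧ t ≤ v.sum fun _ e => e }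

/-- A monomial ideal `J` is stable if for every monomial `x^v ∈ J` and every `j < m(v)`,
where `m(v)` is the largest index of a variable dividing `x^v`, the monomial
`x_j · x^v / x_{m(v)}` also lies in `J`. -/
def IsStable {K : Type*} [Field K] {n : ℕ} (J : Ideal (MvPolynomial (Fin n) K)) : Prop :=
  ∀ v : Fin n →₀ ℕ, monomial v (1 : K) ∈ J →
    ∀ m : Fin n, m ∈ v.support → (∀ i ∈ v.support, i ≤ m) →
      ∀ j : Fin n, j < m →
        monomial (v - Finsupp.single m 1 + Finsupp.single j 1) (1 : K) ∈ J

/-- `RegLE I e` says that the Castelnuovo–Mumford regularity of `I` is at most `e`.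
This is expressed through the standard characterization: there exists a graded free
resolution `⋯ → F_i → ⋯ → F_0 → I → 0` of `I` (with `F_i` free on a finite set `σ i`
of homogeneous generators of degrees `deg i`, the differentials and the augmentation
being graded of degree `0`) in which `F_i` is generated in degrees `≤ e + i` for all
`i`.  The minimal graded free resolution realizes `reg I` exactly, so this holds iff
`reg I ≤ e`. -/
def RegLE {K : Type*} [Field K] {n : ℕ} (I : Ideal (MvPolynomial (Fin n) K)) (e : ℕ) :
    Prop :=
  ∃ (σ : ℕ → Type) (_ : ∀ i, Finite (σ i)) (deg : ∀ i, σ i → ℕ)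
    (d : ∀ i : ℕ, (σ (i + 1) →₀ MvPolynomial (Fin n) K) →ₗ[MvPolynomial (Fin n) K]
        (σ i →₀ MvPolynomial (Fin n) K))
    (ε : (σ 0 →₀ MvPolynomial (Fin n) K) →ₗ[MvPolynomial (Fin n) K]
        MvPolynomial (Fin n) K),
    -- the augmentation maps onto `I`
    LinearMap.range ε = I ∧
    -- the augmentation is graded: the image of a generator of degree `deg 0 k`
    -- is homogeneous of degree `deg 0 k`
    (∀ k : σ 0, ε (Finsupp.single k 1) ∈ homogeneousSubmodule (Fin n) K (deg 0 k)) ∧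
    -- the differentials are graded of degree `0`
    (∀ (i : ℕ) (j : σ (i + 1)) (k : σ i),
        (d i (Finsupp.single j 1)) k ∈
            homogeneousSubmodule (Fin n) K (deg (i + 1) j - deg i k) ∧
          (deg (i + 1) j < deg i k → (d i (Finsupp.single j 1)) k = 0)) ∧
    -- exactness
    LinearMap.range (d 0) = LinearMap.ker ε ∧
    (∀ i : ℕ, LinearMap.range (d (i + 1)) = LinearMap.ker (d i)) ∧
    -- `F_i` is generated in degrees at most `e + i`
    (∀ (i : ℕ) (j : σ i), deg i j ≤ e + i)

/-- The sign `(-1) ^ #{b ∈ τ | b < a}` of the Koszul differential. -/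
def koszulSign {n : ℕ} (a : Fin n) (τ : Finset (Fin n)) : ℤ := (-1) ^ {b ∈ τ | b < a}.card

lemma koszulSign_mul_self {n : ℕ} (a : Fin n) (τ : Finset (Fin n)) :
    koszulSign a τ * koszulSign a τ = 1 := by
  rw [koszulSign, ← pow_add, ← two_mul, pow_mul]
  simp

lemma koszulSign_insert_of_lt {n : ℕ} {a b : Fin n} {τ : Finset (Fin n)} (hb : b ∉ τ)
    (h : b < a) : koszulSign a (insert b τ) = -koszulSign a τ := by
  rw [koszulSign, koszulSign, Finset.filter_insert, if_pos h, Finset.card_insert_of_notMem, pow_succ]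
  · ring
  · simp [hb]

lemma koszulSign_insert_of_le {n : ℕ} {a b : Fin n} {τ : Finset (Fin n)} (h : a ≤ b) :
    koszulSign a (insert b τ) = koszulSign a τ := by
  rw [koszulSign, koszulSign, Finset.filter_insert, if_neg h.not_gt]

lemma koszulSign_mul_insert {n : ℕ} {a b : Fin n} {τ : Finset (Fin n)} (ha : a ∉ τ) (hb : b ∉ τ)
    (hab : a ≠ b) : koszulSign a τ * koszulSign b (insert a τ) =
      -(koszulSign b τ * koszulSign a (insert b τ)) := by
  rcases lt_or_gt_of_ne hab with h | h
  · rw [koszulSign_insert_of_lt ha h, koszulSign_insert_of_le h.le]; ring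
  · rw [koszulSign_insert_of_lt hb h, koszulSign_insert_of_le h.le]; ring

/-- The Koszul differential on `M ⊗ ⋀ Kⁿ`, an element of which is written as a family of
coefficients in `M` indexed by subsets of the variables. -/
def koszul (K : Type*) [Field K] {n : ℕ} {M : Type*} [AddCommGroup M]
    [Module (MvPolynomial (Fin n) K) M] (c : Finset (Fin n) → M) (τ : Finset (Fin n)) : M :=
  ∑ a ∈ τᶜ, koszulSign a τ • (X a : MvPolynomial (Fin n) K) • c (insert a τ)

section Koszul

variable {K : Type*} [Field K] {n : ℕ} {M : Type*} [AddCommGroup M]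
    [Module (MvPolynomial (Fin n) K) M]

lemma koszul_map {M' : Type*} [AddCommGroup M'] [Module (MvPolynomial (Fin n) K) M']
    (φ : M →ₗ[MvPolynomial (Fin n) K] M') (c : Finset (Fin n) → M) (τ : Finset (Fin n)) :
    koszul K (fun ρ => φ (c ρ)) τ = φ (koszul K c τ) := by
  simp [koszul, map_sum, map_zsmul]

lemma koszul_sub (b c : Finset (Fin n) → M) (τ : Finset (Fin n)) :
    koszul K (fun ρ => b ρ - c ρ) τ = koszul K b τ - koszul K c τ := by
  simp [koszul, smul_sub, Finset.sum_sub_distrib]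

lemma koszul_koszul (c : Finset (Fin n) → M) (τ : Finset (Fin n)) :
    koszul K (koszul K c) τ = 0 := by
  simp only [koszul, Finset.smul_sum]
  rw [Finset.sum_sigma']
  refine Finset.sum_involution (fun x _ => ⟨x.2, x.1⟩) ?_ ?_ ?_ ?_
  · rintro ⟨a, b⟩ h
    simp only [Finset.mem_sigma, Finset.mem_compl, Finset.mem_insert, not_or] at h
    obtain ⟨ha, hba, hb⟩ := h
    have hs := koszulSign_mul_insert ha hb (Ne.symm hba)
    simp only [smul_comm (X _ : MvPolynomial (Fin n) K) (koszulSign _ _), smul_smul,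
      Finset.insert_comm b a]
    rw [hs, mul_comm (X b)]
    simp
  · rintro ⟨a, b⟩ h _ heq
    simp only [Finset.mem_sigma, Finset.mem_compl, Finset.mem_insert, not_or] at h
    simp only [Sigma.mk.injEq, heq_eq_eq] at heq
    exact h.2.1 heq.1
  · rintro ⟨a, b⟩ h
    simp only [Finset.mem_sigma, Finset.mem_compl, Finset.mem_insert, not_or] at h ⊢
    exact ⟨h.2.2, Ne.symm h.2.1, h.1⟩
  · rintro ⟨a, b⟩ h
    rfl

end Koszul

section Homotopy

variable {K : Type*} [Field K] {n : ℕ}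

lemma coeff_int_smul (w : Fin n →₀ ℕ) (z : ℤ) (p : MvPolynomial (Fin n) K) :
    coeff w (z • p) = z • coeff w p := by
  rw [← coeffAddMonoidHom_apply, map_zsmul, coeffAddMonoidHom_apply]

/-- Divide by `x_m` those terms of `p` whose last variable is `x_m`, and drop the others. -/
def divLast (m : Fin n) (p : MvPolynomial (Fin n) K) : MvPolynomial (Fin n) K :=
  ∑ w ∈ (p.divMonomial (Finsupp.single m 1)).support with ∀ i ∈ w.support, i ≤ m,
    monomial w (coeff w (p.divMonomial (Finsupp.single m 1)))

lemma coeff_divLast (m : Fin n) (p : MvPolynomial (Fin n) K) (w : Fin n →₀ ℕ) :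
    coeff w (divLast m p) =
      if ∀ i ∈ w.support, i ≤ m then coeff (Finsupp.single m 1 + w) p else 0 := by
  rw [divLast, coeff_sum]
  simp only [coeff_monomial, Finset.sum_ite_eq', Finset.mem_filter, mem_support_iff,
    coeff_divMonomial]
  split_ifs <;> simp_all

/-- The contracting homotopy of the Koszul complex that multiplies each term by the exterior
generator of its last variable. -/
def koszulHomotopy (c : Finset (Fin n) → MvPolynomial (Fin n) K) (τ : Finset (Fin n)) :
    MvPolynomial (Fin n) K :=
  if h : τ.Nonempty then
    koszulSign (τ.max' h) (τ.erase (τ.max' h)) • divLast (τ.max' h) (c (τ.erase (τ.max' h)))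
  else 0

lemma exists_of_coeff_koszulHomotopy_ne_zero {c : Finset (Fin n) → MvPolynomial (Fin n) K}
    {τ : Finset (Fin n)} {w : Fin n →₀ ℕ} (h : coeff w (koszulHomotopy c τ) ≠ 0) :
    ∃ m ρ, (∀ i ∈ w.support, i ≤ m) ∧ coeff (Finsupp.single m 1 + w) (c ρ) ≠ 0 := by
  rw [koszulHomotopy] at h
  split_ifs at h with hτ
  · refine ⟨τ.max' hτ, τ.erase (τ.max' hτ), ?_⟩
    rw [coeff_int_smul, coeff_divLast] at h
    split_ifs at h with hw
    · exact ⟨hw, fun h0 => h (by simp [h0])⟩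
    · simp at h
  · simp at h

lemma koszulHomotopy_insert (c : Finset (Fin n) → MvPolynomial (Fin n) K)
    {ρ : Finset (Fin n)} {m : Fin n} (hm : m ∉ ρ) (hρ : ∀ i ∈ ρ, i ≤ m) :
    koszulHomotopy c (insert m ρ) = koszulSign m ρ • divLast m (c ρ) := by
  have h : (insert m ρ).Nonempty := Finset.insert_nonempty _ _
  have hmax : (insert m ρ).max' h = m := by
    apply le_antisymm
    · apply Finset.max'_le
      intro y hy
      rcases Finset.mem_insert.1 hy with rfl | hy
      · exact le_rfl
      · exact hρ y hy
    · exact Finset.le_max' _ _ (Finset.mem_insert_self _ _)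
  rw [koszulHomotopy, dif_pos h, hmax, Finset.erase_insert hm]

lemma coeff_koszul (c : Finset (Fin n) → MvPolynomial (Fin n) K) (τ : Finset (Fin n))
    (w : Fin n →₀ ℕ) : coeff w (koszul K c τ) = ∑ a ∈ τᶜ, koszulSign a τ •
      if a ∈ w.support then coeff (w - Finsupp.single a 1) (c (insert a τ)) else 0 := by
  simp only [koszul, coeff_sum, coeff_int_smul, smul_eq_mul, coeff_X_mul']

theorem koszul_koszulHomotopy {c : Finset (Fin n) → MvPolynomial (Fin n) K}
    (hc : ∀ τ, koszul K c τ = 0) (h0 : ∀ τ, coeff 0 (c τ) = 0) (τ : Finset (Fin n)) :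
    koszul K (koszulHomotopy c) τ = c τ := by
  ext w
  rw [coeff_koszul]
  by_cases hw : w = 0
  · subst hw
    simp [h0]
  have hne : (w.support ∪ τ).Nonempty := by
    obtain ⟨i, hi⟩ := Finsupp.support_nonempty_iff.2 hw
    exact ⟨i, Finset.mem_union_left _ hi⟩
  obtain ⟨m, hm⟩ : ∃ m, m = (w.support ∪ τ).max' hne := ⟨_, rfl⟩
  have hmem : m ∈ w.support ∪ τ := hm ▸ Finset.max'_mem _ _
  have hle : ∀ i ∈ w.support ∪ τ, i ≤ m := fun i hi => hm ▸ Finset.le_max' _ i hi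
  have hlew : ∀ i ∈ w.support, i ≤ m := fun i hi => hle i (Finset.mem_union_left _ hi)
  have hleτ : ∀ i ∈ τ, i ≤ m := fun i hi => hle i (Finset.mem_union_right _ hi)
  clear hm
  by_cases hmτ : m ∈ τ
  · obtain ⟨ρ, hmρ, rfl⟩ : ∃ ρ, m ∉ ρ ∧ insert m ρ = τ :=
      ⟨τ.erase m, Finset.notMem_erase _ _, Finset.insert_erase hmτ⟩
    have hleρ : ∀ i ∈ ρ, i ≤ m := fun i hi => hleτ i (Finset.mem_insert_of_mem hi)
    have key := congrArg (coeff (Finsupp.single m 1 + w)) (hc ρ)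
    rw [coeff_koszul, ← Finset.add_sum_erase _ _ (Finset.mem_compl.2 hmρ)] at key
    rw [if_pos (by simp), add_tsub_cancel_left, coeff_zero] at key
    have hcompl : (insert m ρ)ᶜ = ρᶜ.erase m := by
      ext; simp
    have := congrArg (koszulSign m ρ • ·) key
    simp only [smul_add, smul_smul, koszulSign_mul_self, one_smul, smul_zero,
      Finset.smul_sum] at this
    rw [hcompl, eq_neg_of_add_eq_zero_left this, ← Finset.sum_neg_distrib]
    refine Finset.sum_congr rfl fun a ha => ?_
    obtain ⟨ham, haρ⟩ := Finset.mem_erase.1 ha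
    rw [Finset.mem_compl] at haρ
    by_cases haw : a ∈ w.support
    · have halt : a < m := lt_of_le_of_ne (hlew a haw) ham
      have haw' : a ∈ (Finsupp.single m 1 + w).support := by
        simp only [Finsupp.mem_support_iff, Finsupp.add_apply] at haw ⊢
        omega
      have hple : Finsupp.single a 1 ≤ w := by
        rw [Finsupp.single_le_iff]
        have := Finsupp.mem_support_iff.1 haw
        omega
      rw [if_pos haw, if_pos haw', Finset.insert_comm, koszulHomotopy_insert, coeff_int_smul,
        coeff_divLast, if_pos, smul_smul, koszulSign_insert_of_le halt.le,
        koszulSign_insert_of_lt haρ halt, ← add_tsub_assoc_of_le hple, ← neg_smul]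
      · congr 1; ring
      · intro i hi
        apply hlew
        simp only [Finsupp.mem_support_iff, Finsupp.tsub_apply] at hi ⊢
        omega
      · simp [hmρ, Ne.symm ham]
      · intro i hi
        rcases Finset.mem_insert.1 hi with rfl | hi
        · exact halt.le
        · exact hleρ i hi
    · rw [if_neg haw, if_neg]
      · simp
      · simpa [Finsupp.single_apply, Ne.symm ham] using haw
  · have hmw : m ∈ w.support := (Finset.mem_union.1 hmem).resolve_right hmτ
    have hple : Finsupp.single m 1 ≤ w := by
      rw [Finsupp.single_le_iff]
      have := Finsupp.mem_support_iff.1 hmw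
      omega
    rw [Finset.sum_eq_single_of_mem m (Finset.mem_compl.2 hmτ)]
    · rw [if_pos hmw, koszulHomotopy_insert c hmτ hleτ, coeff_int_smul, coeff_divLast, if_pos,
        smul_smul, koszulSign_mul_self, one_smul, add_tsub_cancel_of_le hple]
      intro i hi
      apply hlew
      simp only [Finsupp.mem_support_iff, Finsupp.tsub_apply] at hi ⊢
      omega
    · intro a ha ham
      rw [Finset.mem_compl] at ha
      split_ifs with haw
      · have halt : a < m := lt_of_le_of_ne (hlew a haw) ham
        rw [koszulHomotopy, dif_pos (Finset.insert_nonempty _ _), coeff_int_smul, coeff_divLast,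
          if_neg]
        · simp
        · intro hall
          have h1 := hall m (by
            simpa [Finsupp.single_apply, ham] using hmw)
          have h2 := Finset.max'_mem _ (Finset.insert_nonempty a τ)
          rcases Finset.mem_insert.1 h2 with h2 | h2
          · rw [h2] at h1; exact absurd h1 halt.not_ge
          · exact hmτ ((le_antisymm h1 (hleτ _ h2)) ▸ h2)
      · simp

end Homotopy

section Graded

variable {K : Type*} [Field K] {n r r' : ℕ}

/-- The degree `d` part of the free module on generators of degrees `deg k`. -/
def homogPart (K : Type*) [Field K] (n : ℕ) {r : ℕ} (deg : Fin r → ℕ) (d : ℕ) :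
    AddSubgroup (Fin r →₀ MvPolynomial (Fin n) K) where
  carrier := {f | ∀ k w, coeff w (f k) ≠ 0 → w.degree + deg k = d}
  zero_mem' := by simp
  add_mem' := by
    intro f g hf hg k w h
    by_cases h1 : coeff w (f k) = 0
    · exact hg k w fun h2 => h (by simp [h1, h2])
    · exact hf k w h1
  neg_mem' := by
    intro f hf k w h
    exact hf k w (by simpa using h)

lemma X_smul_mem_homogPart {deg : Fin r → ℕ} {d : ℕ} {f : Fin r →₀ MvPolynomial (Fin n) K}
    (hf : f ∈ homogPart K n deg d) (a : Fin n) :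
    (X a : MvPolynomial (Fin n) K) • f ∈ homogPart K n deg (d + 1) := by
  intro k w h
  rw [Finsupp.smul_apply, smul_eq_mul, coeff_X_mul'] at h
  split_ifs at h with ha
  · have := hf k _ h
    have hple : Finsupp.single a 1 ≤ w := by
      rw [Finsupp.single_le_iff]
      have := Finsupp.mem_support_iff.1 ha
      omega
    rw [← tsub_add_cancel_of_le hple, map_add, Finsupp.degree_single]
    omega
  · exact absurd rfl h

lemma koszul_mem_homogPart {deg : Fin r → ℕ} {d : ℕ}
    {c : Finset (Fin n) → Fin r →₀ MvPolynomial (Fin n) K}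
    (hc : ∀ τ, c τ ∈ homogPart K n deg d) (τ : Finset (Fin n)) :
    koszul K c τ ∈ homogPart K n deg (d + 1) :=
  sum_mem fun a _ => zsmul_mem (X_smul_mem_homogPart (hc _) a) _

/-- The degree `d` component of an element of a graded free module. -/
def homogComp (deg : Fin r → ℕ) (d : ℕ) (f : Fin r →₀ MvPolynomial (Fin n) K) :
    Fin r →₀ MvPolynomial (Fin n) K :=
  Finsupp.equivFunOnFinite.symm fun k =>
    if deg k ≤ d then homogeneousComponent (d - deg k) (f k) else 0

lemma coeff_homogComp (deg : Fin r → ℕ) (d : ℕ) (f : Fin r →₀ MvPolynomial (Fin n) K)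
    (k : Fin r) (w : Fin n →₀ ℕ) : coeff w (homogComp deg d f k) =
      if w.degree + deg k = d then coeff w (f k) else 0 := by
  simp only [homogComp, Finsupp.equivFunOnFinite_symm_apply_apply]
  split_ifs with h1 h2 h2
  · rw [coeff_homogeneousComponent, if_pos (by omega)]
  · rw [coeff_homogeneousComponent, if_neg (by omega)]
  · omega
  · simp

lemma homogComp_mem (deg : Fin r → ℕ) (d : ℕ) (f : Fin r →₀ MvPolynomial (Fin n) K) :
    homogComp deg d f ∈ homogPart K n deg d := by
  intro k w h
  rw [coeff_homogComp] at h
  by_contra h0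
  exact h (if_neg h0)

lemma homogComp_of_mem {deg : Fin r → ℕ} {d : ℕ} {f : Fin r →₀ MvPolynomial (Fin n) K}
    (hf : f ∈ homogPart K n deg d) (d' : ℕ) :
    homogComp deg d' f = if d = d' then f else 0 := by
  ext k w
  rw [coeff_homogComp]
  by_cases h : coeff w (f k) = 0
  · split_ifs <;> simp [h]
  · rw [hf k w h]
    split_ifs <;> simp

lemma homogComp_sum {ι : Type*} (deg : Fin r → ℕ) (d : ℕ) (s : Finset ι)
    (f : ι → Fin r →₀ MvPolynomial (Fin n) K) :
    homogComp deg d (∑ i ∈ s, f i) = ∑ i ∈ s, homogComp deg d (f i) := by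
  ext k w
  simp only [coeff_homogComp, Finsupp.finsetSum_apply, coeff_sum]
  split_ifs <;> simp

lemma exists_sum_homogComp (deg : Fin r → ℕ) (f : Fin r →₀ MvPolynomial (Fin n) K) (d : ℕ) :
    ∃ D, d < D ∧ ∑ i ∈ Finset.range D, homogComp deg i f = f := by
  refine ⟨d + 1 + ∑ k, ((f k).totalDegree + deg k + 1), by omega, ?_⟩
  ext k w
  simp only [coeff_homogComp, Finsupp.finsetSum_apply, coeff_sum]
  rw [Finset.sum_ite_eq]
  split_ifs with h
  · rfl
  · by_contra h0
    apply h
    have h1 : w.degree ≤ (f k).totalDegree := le_totalDegree (mem_support_iff.2 (Ne.symm h0))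
    have h2 := Finset.single_le_sum (f := fun k => (f k).totalDegree + deg k + 1)
      (fun _ _ => Nat.zero_le _) (Finset.mem_univ k)
    rw [Finset.mem_range]
    omega

lemma map_mem_homogPart {deg : Fin r → ℕ} {deg' : Fin r' → ℕ}
    {φ : (Fin r' →₀ MvPolynomial (Fin n) K) →ₗ[MvPolynomial (Fin n) K]
      (Fin r →₀ MvPolynomial (Fin n) K)}
    (hφ : ∀ j, φ (Finsupp.single j 1) ∈ homogPart K n deg (deg' j)) {d : ℕ}
    {f : Fin r' →₀ MvPolynomial (Fin n) K} (hf : f ∈ homogPart K n deg' d) :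
    φ f ∈ homogPart K n deg d := by
  rw [← Finsupp.sum_single f, Finsupp.sum, map_sum]
  refine sum_mem fun j _ k w h => ?_
  rw [← mul_one (f j), ← smul_eq_mul, ← Finsupp.smul_single, map_smul, Finsupp.smul_apply,
    smul_eq_mul, coeff_mul] at h
  obtain ⟨⟨u, u'⟩, hu, hne⟩ := Finset.exists_ne_zero_of_sum_ne_zero h
  have h1 := hf j u (left_ne_zero_of_mul hne)
  have h2 := hφ j k u' (right_ne_zero_of_mul hne)
  rw [← Finset.HasAntidiagonal.mem_antidiagonal.1 hu, map_add]
  dsimp only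
  omega

lemma map_homogComp {deg : Fin r → ℕ} {deg' : Fin r' → ℕ}
    {φ : (Fin r' →₀ MvPolynomial (Fin n) K) →ₗ[MvPolynomial (Fin n) K]
      (Fin r →₀ MvPolynomial (Fin n) K)}
    (hφ : ∀ j, φ (Finsupp.single j 1) ∈ homogPart K n deg (deg' j)) (d : ℕ)
    (f : Fin r' →₀ MvPolynomial (Fin n) K) :
    φ (homogComp deg' d f) = homogComp deg d (φ f) := by
  obtain ⟨D, hD, hf⟩ := exists_sum_homogComp deg' f d
  conv_rhs => rw [← hf, map_sum, homogComp_sum]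
  simp only [homogComp_of_mem (map_mem_homogPart hφ (homogComp_mem deg' _ f))]
  rw [Finset.sum_ite_eq', if_pos (Finset.mem_range.2 hD)]

/-- A submodule of a graded free module is graded if it contains the homogeneous components of
its elements. -/
def IsGradedSubmodule (deg : Fin r → ℕ)
    (N : Submodule (MvPolynomial (Fin n) K) (Fin r →₀ MvPolynomial (Fin n) K)) : Prop :=
  ∀ f ∈ N, ∀ d, homogComp deg d f ∈ N

/-- The Koszul homology of `N` vanishes in all coefficient degrees above `e`; equivalently,
`N` has regularity at most `e`. -/
def KoszulRegLE (deg : Fin r → ℕ)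
    (N : Submodule (MvPolynomial (Fin n) K) (Fin r →₀ MvPolynomial (Fin n) K)) (e : ℕ) : Prop :=
  ∀ d, e ≤ d → ∀ c : Finset (Fin n) → Fin r →₀ MvPolynomial (Fin n) K,
    (∀ τ, c τ ∈ N ∧ c τ ∈ homogPart K n deg (d + 1)) → (∀ τ, koszul K c τ = 0) →
    ∃ b : Finset (Fin n) → Fin r →₀ MvPolynomial (Fin n) K,
      (∀ τ, b τ ∈ N ∧ b τ ∈ homogPart K n deg d) ∧ ∀ τ, koszul K b τ = c τ

/-- The contracting homotopy applied in each coordinate of a free module. -/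
def koszulHomotopyFree (c : Finset (Fin n) → Fin r →₀ MvPolynomial (Fin n) K)
    (τ : Finset (Fin n)) : Fin r →₀ MvPolynomial (Fin n) K :=
  Finsupp.equivFunOnFinite.symm fun k => koszulHomotopy (fun ρ => c ρ k) τ

lemma koszulHomotopyFree_apply (c : Finset (Fin n) → Fin r →₀ MvPolynomial (Fin n) K)
    (τ : Finset (Fin n)) (k : Fin r) :
    koszulHomotopyFree c τ k = koszulHomotopy (fun ρ => c ρ k) τ := rfl

lemma koszulHomotopyFree_mem {deg : Fin r → ℕ} {d : ℕ}
    {c : Finset (Fin n) → Fin r →₀ MvPolynomial (Fin n) K}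
    (hc : ∀ τ, c τ ∈ homogPart K n deg (d + 1)) (τ : Finset (Fin n)) :
    koszulHomotopyFree c τ ∈ homogPart K n deg d := by
  intro k w h
  rw [koszulHomotopyFree_apply] at h
  obtain ⟨m, ρ, -, hne⟩ := exists_of_coeff_koszulHomotopy_ne_zero h
  have := hc ρ k _ hne
  rw [map_add, Finsupp.degree_single] at this
  omega

lemma koszul_koszulHomotopyFree {deg : Fin r → ℕ} {d : ℕ} (hdeg : ∀ k, deg k ≤ d)
    {c : Finset (Fin n) → Fin r →₀ MvPolynomial (Fin n) K}
    (hc : ∀ τ, c τ ∈ homogPart K n deg (d + 1)) (hc0 : ∀ τ, koszul K c τ = 0)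
    (τ : Finset (Fin n)) : koszul K (koszulHomotopyFree c) τ = c τ := by
  refine Finsupp.ext fun k => ?_
  have hk := fun c ρ => koszul_map (K := K) (n := n)
    (Finsupp.lapply k : (Fin r →₀ MvPolynomial (Fin n) K) →ₗ[MvPolynomial (Fin n) K] _) c ρ
  simp only [Finsupp.lapply_apply] at hk
  rw [← hk]
  simp only [koszulHomotopyFree_apply]
  refine koszul_koszulHomotopy (fun ρ => ?_) (fun ρ => ?_) τ
  · rw [hk, hc0, Finsupp.zero_apply]
  · by_contra h
    have h1 := hc ρ k 0 h
    have h2 := hdeg k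
    rw [map_zero] at h1
    omega

/-- The homogeneous elements of degree at most `e` of `N` generate `N`. -/
lemma KoszulRegLE.le_span {deg : Fin r → ℕ}
    {N : Submodule (MvPolynomial (Fin n) K) (Fin r →₀ MvPolynomial (Fin n) K)} {e : ℕ}
    (hN : KoszulRegLE deg N e) (hgr : IsGradedSubmodule deg N) :
    N ≤ Submodule.span (MvPolynomial (Fin n) K)
      {f | f ∈ N ∧ ∃ d ≤ e, f ∈ homogPart K n deg d} := by
  have main : ∀ d f, f ∈ N → f ∈ homogPart K n deg d → f ∈
      Submodule.span (MvPolynomial (Fin n) K) {f | f ∈ N ∧ ∃ d ≤ e, f ∈ homogPart K n deg d} := by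
    intro d
    induction d with
    | zero => exact fun f hf hf0 => Submodule.subset_span ⟨hf, 0, Nat.zero_le _, hf0⟩
    | succ d ih =>
      intro f hf hfd
      rcases Nat.lt_or_ge d e with hde | hde
      · exact Submodule.subset_span ⟨hf, d + 1, hde, hfd⟩
      obtain ⟨b, hb, hbf⟩ := hN d hde (fun τ => if τ = ∅ then f else 0)
        (fun τ => by split_ifs <;> simp [hf, hfd]) (fun τ => by simp [koszul])
      have := hbf ∅
      rw [if_pos rfl] at this
      rw [← this]
      exact sum_mem fun a _ => zsmul_mem (Submodule.smul_mem _ _ (ih _ (hb _).1 (hb _).2)) _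
  intro f hf
  obtain ⟨D, -, hD⟩ := exists_sum_homogComp deg f 0
  rw [← hD]
  exact sum_mem fun i _ => main i _ (hgr f hf i) (homogComp_mem _ _ _)

lemma KoszulRegLE.exists_presentation {deg : Fin r → ℕ}
    {N : Submodule (MvPolynomial (Fin n) K) (Fin r →₀ MvPolynomial (Fin n) K)} {e : ℕ}
    (hN : KoszulRegLE deg N e) (hgr : IsGradedSubmodule deg N) :
    ∃ (s : ℕ) (deg' : Fin s → ℕ) (φ : (Fin s →₀ MvPolynomial (Fin n) K) →ₗ[MvPolynomial (Fin n) K]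
      (Fin r →₀ MvPolynomial (Fin n) K)), (∀ j, deg' j ≤ e) ∧
      (∀ j, φ (Finsupp.single j 1) ∈ homogPart K n deg (deg' j)) ∧ LinearMap.range φ = N := by
  set B := {f | f ∈ N ∧ ∃ d ≤ e, f ∈ homogPart K n deg d}
  have hspan : Submodule.span (MvPolynomial (Fin n) K) B = N :=
    le_antisymm (Submodule.span_le.2 fun f hf => hf.1) (hN.le_span hgr)
  obtain ⟨t, htB, ht⟩ := (Submodule.fg_span_iff_fg_span_finset_subset B).1
    (IsNoetherian.noetherian (Submodule.span (MvPolynomial (Fin n) K) B))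
  have hmem : ∀ j : Fin t.card, (t.equivFin.symm j : Fin r →₀ MvPolynomial (Fin n) K) ∈ B :=
    fun j => htB (t.equivFin.symm j).2
  choose deg' hle hmem' using fun j => (hmem j).2
  refine ⟨t.card, deg', Finsupp.linearCombination _ fun j => (t.equivFin.symm j : _), hle,
    fun j => ?_, ?_⟩
  · simpa using hmem' j
  · rw [Finsupp.range_linearCombination, ← hspan, ht]
    congr 1
    ext f
    constructor
    · rintro ⟨j, rfl⟩
      exact (t.equivFin.symm j).2
    · intro hf
      exact ⟨t.equivFin ⟨f, hf⟩, by simp⟩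

lemma isGradedSubmodule_ker {deg : Fin r → ℕ} {deg' : Fin r' → ℕ}
    {φ : (Fin r' →₀ MvPolynomial (Fin n) K) →ₗ[MvPolynomial (Fin n) K]
      (Fin r →₀ MvPolynomial (Fin n) K)}
    (hφ : ∀ j, φ (Finsupp.single j 1) ∈ homogPart K n deg (deg' j)) :
    IsGradedSubmodule deg' (LinearMap.ker φ) := by
  intro f hf d
  rw [LinearMap.mem_ker] at hf ⊢
  rw [map_homogComp hφ, hf, homogComp_of_mem (d := d) (zero_mem _), ite_self]

lemma KoszulRegLE.ker {deg : Fin r → ℕ} {deg' : Fin r' → ℕ} {e : ℕ}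
    {φ : (Fin r' →₀ MvPolynomial (Fin n) K) →ₗ[MvPolynomial (Fin n) K]
      (Fin r →₀ MvPolynomial (Fin n) K)}
    (hN : KoszulRegLE deg (LinearMap.range φ) e)
    (hφ : ∀ j, φ (Finsupp.single j 1) ∈ homogPart K n deg (deg' j)) (hdeg : ∀ j, deg' j ≤ e) :
    KoszulRegLE deg' (LinearMap.ker φ) (e + 1) := by
  intro d hd c hc hc0
  obtain ⟨d, rfl⟩ : ∃ d', d = d' + 1 := ⟨d - 1, by omega⟩
  have hb := koszulHomotopyFree_mem fun τ => (hc τ).2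
  have hbc := koszul_koszulHomotopyFree (fun k => (hdeg k).trans (by omega))
    (fun τ => (hc τ).2) hc0
  set b := koszulHomotopyFree c
  obtain ⟨b', hb', hbb'⟩ := hN d (by omega) (fun τ => φ (b τ))
    (fun τ => ⟨⟨_, rfl⟩, map_mem_homogPart hφ (hb τ)⟩)
    (fun τ => by rw [koszul_map, hbc]; exact (hc τ).1)
  have hlift : ∀ τ, ∃ g, g ∈ homogPart K n deg' d ∧ φ g = b' τ := by
    intro τ
    obtain ⟨g, hg⟩ := (hb' τ).1
    refine ⟨homogComp deg' d g, homogComp_mem _ _ _, ?_⟩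
    rw [map_homogComp hφ, hg, homogComp_of_mem (hb' τ).2, if_pos rfl]
  choose g hg hgb using hlift
  refine ⟨fun τ => b τ - koszul K g τ, fun τ => ⟨?_, ?_⟩, fun τ => ?_⟩
  · rw [LinearMap.mem_ker, map_sub, ← koszul_map]
    simp only [hgb]
    rw [hbb', sub_self]
  · exact sub_mem (hb τ) (koszul_mem_homogPart hg τ)
  · rw [koszul_sub b (koszul K g), koszul_koszul, sub_zero, hbc]

end Graded

section Resolution

variable {K : Type*} [Field K] {n : ℕ}

/-- A graded submodule of a graded free module, of regularity at most `e`. -/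
structure GradedSyzygy (K : Type*) [Field K] (n e : ℕ) where
  rank : ℕ
  deg : Fin rank → ℕ
  carrier : Submodule (MvPolynomial (Fin n) K) (Fin rank →₀ MvPolynomial (Fin n) K)
  graded : IsGradedSubmodule deg carrier
  reg : KoszulRegLE deg carrier e

lemma GradedSyzygy.exists_next {e : ℕ} (N : GradedSyzygy K n e) :
    ∃ (N' : GradedSyzygy K n (e + 1))
      (φ : (Fin N'.rank →₀ MvPolynomial (Fin n) K) →ₗ[MvPolynomial (Fin n) K]
        (Fin N.rank →₀ MvPolynomial (Fin n) K)),
      (∀ j, N'.deg j ≤ e) ∧ (∀ j, φ (Finsupp.single j 1) ∈ homogPart K n N.deg (N'.deg j)) ∧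
      LinearMap.range φ = N.carrier ∧ N'.carrier = LinearMap.ker φ := by
  obtain ⟨s, deg', φ, hdeg, hφ, hrange⟩ := N.reg.exists_presentation N.graded
  exact ⟨⟨s, deg', LinearMap.ker φ, isGradedSubmodule_ker hφ,
    KoszulRegLE.ker (hrange ▸ N.reg) hφ hdeg⟩, φ, hdeg, hφ, hrange, rfl⟩

/-- Iterated syzygies of `N`. -/
def GradedSyzygy.iterate {e : ℕ} (N : GradedSyzygy K n e) : ∀ i : ℕ, GradedSyzygy K n (e + i)
  | 0 => N
  | i + 1 => (N.iterate i).exists_next.choose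

lemma entry_of_mem_homogPart {r : ℕ} {deg : Fin r → ℕ} {d : ℕ}
    {f : Fin r →₀ MvPolynomial (Fin n) K} (hf : f ∈ homogPart K n deg d) (k : Fin r) :
    f k ∈ homogeneousSubmodule (Fin n) K (d - deg k) ∧ (d < deg k → f k = 0) := by
  refine ⟨?_, fun h => ?_⟩
  · rw [mem_homogeneousSubmodule]
    intro w hw
    have := hf k w hw
    refine (DFunLike.congr_fun Finsupp.degree_eq_weight_one w).symm.trans ?_
    omega
  · ext w
    by_contra hw
    have := hf k w hw
    omega

/-- An ideal whose Koszul homology vanishes above `e` has regularity at most `e`. -/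
theorem regLE_of_koszulRegLE {I : Ideal (MvPolynomial (Fin n) K)} {e : ℕ}
    (hgr : IsGradedSubmodule (fun _ : Fin 1 => 0)
      (Submodule.comap (Finsupp.lapply (0 : Fin 1)) I))
    (hreg : KoszulRegLE (fun _ : Fin 1 => 0)
      (Submodule.comap (Finsupp.lapply (0 : Fin 1)) I) e) : RegLE I e := by
  let N : GradedSyzygy K n e := ⟨1, fun _ => 0, _, hgr, hreg⟩
  choose φ hdeg hφ hrange hker using fun i => (N.iterate i).exists_next.choose_spec
  have hinj : LinearMap.ker (Finsupp.lapply (0 : Fin 1) : (Fin 1 →₀ MvPolynomial (Fin n) K)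
      →ₗ[MvPolynomial (Fin n) K] MvPolynomial (Fin n) K) = ⊥ := by
    rw [LinearMap.ker_eq_bot]
    intro f g hfg
    refine Finsupp.ext fun k => ?_
    rw [Subsingleton.elim k 0]
    exact hfg
  refine ⟨fun i => Fin (N.iterate (i + 1)).rank, fun i => inferInstance,
    fun i => (N.iterate (i + 1)).deg, fun i => φ (i + 1),
    (Finsupp.lapply (0 : Fin 1)).comp (φ 0), ?_, fun k => ?_, fun i j k => ?_, ?_, fun i => ?_,
    fun i => hdeg i⟩
  · refine (LinearMap.range_comp (φ 0) (Finsupp.lapply (0 : Fin 1))).trans ?_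
    refine (congrArg (Submodule.map (Finsupp.lapply (0 : Fin 1))) (hrange 0)).trans ?_
    refine Submodule.map_comap_eq_of_surjective (fun p => ⟨Finsupp.single 0 p, ?_⟩) I
    simp
  · exact (entry_of_mem_homogPart (hφ 0 k) (0 : Fin 1)).1
  · exact entry_of_mem_homogPart (hφ (i + 1) j) k
  · exact ((hrange 1).trans (hker 0)).trans (LinearMap.ker_comp_of_ker_eq_bot (φ 0) hinj).symm
  · exact (hrange (i + 2)).trans (hker (i + 1))

end Resolution

section Monomial

variable {K : Type*} [Field K] {n : ℕ}

lemma monomial_mem_span_iff (G : Set (Fin n →₀ ℕ)) (v : Fin n →₀ ℕ) :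
    monomial v (1 : K) ∈ Ideal.span ((fun v => monomial v (1 : K)) '' G) ↔ ∃ g ∈ G, g ≤ v := by
  rw [mem_ideal_span_monomial_image]
  simp

lemma monomial_mem_trunc_iff (G : Set (Fin n →₀ ℕ)) (e : ℕ) (v : Fin n →₀ ℕ) :
    monomial v (1 : K) ∈ trunc (Ideal.span ((fun v => monomial v (1 : K)) '' G)) e ↔
      (∃ g ∈ G, g ≤ v) ∧ e ≤ v.degree := by
  have : { p | ∃ v : Fin n →₀ ℕ, p = monomial v (1 : K) ∧
      p ∈ Ideal.span ((fun v => monomial v (1 : K)) '' G) ∧ e ≤ v.sum fun _ e => e } =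
      (fun v => monomial v (1 : K)) '' {v | (∃ g ∈ G, g ≤ v) ∧ e ≤ v.degree} := by
    ext p
    constructor
    · rintro ⟨v, rfl, hv, hev⟩
      exact ⟨v, ⟨(monomial_mem_span_iff G v).1 hv, hev⟩, rfl⟩
    · rintro ⟨v, ⟨hv, hev⟩, rfl⟩
      exact ⟨v, rfl, (monomial_mem_span_iff G v).2 hv, hev⟩
  rw [trunc, this, monomial_mem_span_iff]
  constructor
  · rintro ⟨u, ⟨⟨g, hg, hgu⟩, heu⟩, huv⟩
    exact ⟨⟨g, hg, hgu.trans huv⟩, heu.trans (Finsupp.degree_mono huv)⟩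
  · rintro h
    exact ⟨v, h, le_rfl⟩

/-- If `I_{≥e}` is stable, a monomial of `I` of degree greater than `e` stays in `I` when divided
by its last variable. -/
lemma exists_le_of_isStable_trunc {G : Set (Fin n →₀ ℕ)} {e : ℕ}
    (hdeg : ∀ v ∈ G, v.degree ≤ e)
    (hstable : IsStable (trunc (Ideal.span ((fun v => monomial v (1 : K)) '' G)) e))
    {w : Fin n →₀ ℕ} {m : Fin n} (hw : ∀ i ∈ w.support, i ≤ m) (hew : e ≤ w.degree)
    (hG : ∃ g ∈ G, g ≤ Finsupp.single m 1 + w) : ∃ g ∈ G, g ≤ w := by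
  obtain ⟨g, hg, hgw⟩ := hG
  by_cases hle : g ≤ w
  · exact ⟨g, hg, hle⟩
  have hlt : ∃ a, g a < (Finsupp.single m 1 + w : Fin n →₀ ℕ) a := by
    by_contra! h
    have h1 := Finsupp.degree_mono (show Finsupp.single m 1 + w ≤ g from h)
    rw [map_add, Finsupp.degree_single] at h1
    have := hdeg g hg
    omega
  obtain ⟨a, ha⟩ := hlt
  have hgm : w m < g m := by
    by_contra! h
    refine hle fun i => ?_
    rcases eq_or_ne i m with rfl | him
    · exact h
    · simpa [Finsupp.single_apply, him.symm] using hgw i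
  have ham : a ≠ m := by
    rintro rfl
    simp at ha
    omega
  have hga : g a < w a := by simpa [Finsupp.single_apply, ham.symm] using ha
  have halt : a < m := lt_of_le_of_ne (hw a (by simp; omega)) ham
  have hple : Finsupp.single a 1 ≤ w := by
    rw [Finsupp.single_le_iff]
    omega
  obtain ⟨u, rfl⟩ := exists_add_of_le hple
  have hmem := hstable (Finsupp.single m 1 + u) ((monomial_mem_trunc_iff G e _).2
    ⟨⟨g, hg, fun i => ?_⟩, by simpa [map_add] using hew⟩) m (by simp) (fun i hi => ?_) a halt
  · rw [add_tsub_cancel_left, add_comm, monomial_mem_trunc_iff] at hmem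
    exact hmem.1
  · rcases eq_or_ne i a with rfl | hia
    · simp [ham.symm] at hga ⊢
      omega
    · simpa [Finsupp.single_apply, hia.symm] using hgw i
  · rcases eq_or_ne i m with rfl | him
    · exact le_rfl
    · apply hw
      simp [Finsupp.single_apply, him.symm] at hi ⊢
      omega

end Monomial

/-- If `I` is a monomial ideal (given by its minimal monomial generators
`x^v`, `v ∈ G`, an antichain of exponent vectors) and `e ≥ deg I` is an integer such
that `I_{≥e}` is stable, then `reg I ≤ e`. -/
theorem stmt12 {K : Type*} [Field K] {n : ℕ} (G : Finset (Fin n →₀ ℕ))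
    (hmin : ∀ v ∈ G, ∀ w ∈ G, v ≤ w → v = w)
    (e : ℕ) (hdeg : ∀ v ∈ G, (v.sum fun _ m => m) ≤ e)
    (hstable : IsStable (trunc (Ideal.span
        ((fun v => monomial v (1 : K)) '' (G : Set (Fin n →₀ ℕ)))) e)) :
    RegLE (Ideal.span ((fun v => monomial v (1 : K)) '' (G : Set (Fin n →₀ ℕ)))) e := by
  refine regLE_of_koszulRegLE (fun f hf d => ?_) (fun d hd c hc hc0 => ?_)
  · rw [Submodule.mem_comap, Finsupp.lapply_apply, mem_ideal_span_monomial_image] at hf ⊢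
    intro w hw
    rw [mem_support_iff, coeff_homogComp] at hw
    exact hf w (mem_support_iff.2 fun h0 => hw (by simp [h0]))
  · refine ⟨koszulHomotopyFree c,
      fun τ => ⟨?_, koszulHomotopyFree_mem (fun ρ => (hc ρ).2) τ⟩,
      koszul_koszulHomotopyFree (fun _ => Nat.zero_le _) (fun ρ => (hc ρ).2) hc0⟩
    rw [Submodule.mem_comap, Finsupp.lapply_apply, mem_ideal_span_monomial_image]
    intro w hw
    rw [mem_support_iff, koszulHomotopyFree_apply] at hw
    obtain ⟨m, ρ, hm, hne⟩ := exists_of_coeff_koszulHomotopy_ne_zero hw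
    have hdw := (hc ρ).2 0 _ hne
    rw [map_add, Finsupp.degree_single] at hdw
    dsimp only at hdw
    have hcI := (hc ρ).1
    rw [Submodule.mem_comap, Finsupp.lapply_apply, mem_ideal_span_monomial_image] at hcI
    exact exists_le_of_isStable_trunc hdeg hstable hm (by omega)
      (hcI _ (mem_support_iff.2 hne))
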